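/- Arrow's Impossibility Theorem (extended form): Let 𝒜 be finite with at least 3 elements and let N ≥ 2. If a Social Welfare Function w : P̄^N → P̄ satisfies Unanimity, IIA, and has no dictator at any individual, then there exist profiles q, q' ∈ P^N such that (1) w(q) = w(q') = 𝐜, and (2) q and q' are inconsistent, i.e., q_j ⊓ q'_j = 𝐜 for some coordinate j. -/

import Mathlib

/-- A weak order on `A`: a transitive and complete (total) binary relation. -/
structure WeakOrder (A : Type*) where
  rel : A → A → Prop
  trans : ∀ a b c, rel a b → rel b c → rel a c
  total : ∀ a b, rel a b ∨ rel b a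

namespace WeakOrder

/-- Strict preference: `a ≺ b` in `r`. -/
def strict {A : Type*} (r : WeakOrder A) (a b : A) : Prop := r.rel a b ∧ ¬ r.rel b a

/-- The reversed (converse) weak order. -/
def reverse {A : Type*} (r : WeakOrder A) : WeakOrder A :=
  ⟨fun a b => r.rel b a, fun a b c h1 h2 => r.trans c b a h2 h1, fun a b => r.total b a⟩

end WeakOrder

/-- The totally indifferent weak order `𝐢`. -/
def indiff (A : Type*) : WeakOrder A :=
  ⟨fun _ _ => True, fun _ _ _ _ _ => trivial, fun _ _ => Or.inl trivial⟩

/-- The strictness ordering on weak orders: `r ≤ s` iff every strict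
preference of `s` is a strict preference of `r`. -/
def strLE {A : Type*} (r s : WeakOrder A) : Prop :=
  ∀ a b, s.strict a b → r.strict a b

/-- `P̄ = P ∪ {𝐜}`, with `none` playing the role of the contradictory
preference cycle `𝐜` and `some r` the weak order `r`. -/
abbrev Pbar (A : Type*) := Option (WeakOrder A)

/-- The strictness ordering extended to `P̄`, with `𝐜 = none` as bottom. -/
def barLE {A : Type*} : Pbar A → Pbar A → Prop
  | none, _ => True
  | some _, none => False
  | some r, some s => strLE r s

/-- `t` is a greatest lower bound of `r` and `s` in `(P̄, ≤)`. -/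
def IsGLBbar {A : Type*} (r s t : Pbar A) : Prop :=
  barLE t r ∧ barLE t s ∧ ∀ u, barLE u r → barLE u s → barLE u t

/-- `t` is a least upper bound of `r` and `s` in `(P̄, ≤)`. -/
def IsLUBbar {A : Type*} (r s t : Pbar A) : Prop :=
  barLE r t ∧ barLE s t ∧ ∀ u, barLE r u → barLE s u → barLE t u

open Classical in
/-- `r ⊓ s`: the greatest lower bound of `r` and `s` in `(P̄, ≤)` (which always
exists; `𝐜` as a default value otherwise). -/
noncomputable def pinf {A : Type*} (r s : Pbar A) : Pbar A :=
  if h : ∃ t, IsGLBbar r s t then h.choose else none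

/-- `t` is a least upper bound of the weak orders `r` and `s` in the
strictness ordering on `P`. -/
def IsLUBw {A : Type*} (r s t : WeakOrder A) : Prop :=
  strLE r t ∧ strLE s t ∧ ∀ u, strLE r u → strLE s u → strLE t u

/-- `t` is a greatest lower bound of the weak orders `r` and `s` in the
strictness ordering on `P`. -/
def IsGLBw {A : Type*} (r s t : WeakOrder A) : Prop :=
  strLE t r ∧ strLE t s ∧ ∀ u, strLE u r → strLE u s → strLE u t

open Classical in
/-- `r ⊔ s`: the least upper bound of two weak orders in the strictness
ordering (which always exists; default value otherwise). -/
noncomputable def wsup {A : Type*} (r s : WeakOrder A) : WeakOrder A :=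
  if h : ∃ t, IsLUBw r s t then h.choose else indiff A

/-- The join `+ : P̄ × P̄ → P̄`: `r + s = r ⊔ s` when both are weak orders,
and `𝐢` otherwise. -/
noncomputable def pjoin {A : Type*} : Pbar A → Pbar A → Pbar A
  | some r, some s => some (wsup r s)
  | _, _ => some (indiff A)

open Classical in
/-- Negation on `P̄`: `¬𝐜 = 𝐢`, `¬𝐢 = 𝐜`, and otherwise the weak order with
all strict preferences reversed. -/
noncomputable def pneg {A : Type*} : Pbar A → Pbar A
  | none => some (indiff A)
  | some r => if r = indiff A then none else some r.reverse

/-- The inclusion `P^N ⊆ P̄^N` of profiles of weak orders. -/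
def coeP {A : Type*} {N : ℕ} (p : Fin N → WeakOrder A) : Fin N → Pbar A :=
  fun j => some (p j)

/-- `w` has a dictator at individual `i`. -/
def HasDictatorAt {A : Type*} {N : ℕ} (w : (Fin N → Pbar A) → Pbar A) (i : Fin N) : Prop :=
  ∀ p : Fin N → WeakOrder A,
    (w (coeP p) = none → p i = indiff A) ∧
    (p i ≠ indiff A → barLE (w (coeP p)) (some (p i)))

/-- The application function `Ω_i`. -/
noncomputable def Omega {A : Type*} {N : ℕ} (i : Fin N) (p : Fin N → Pbar A) (r : Pbar A) :
    Fin N → Pbar A :=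
  fun j => if j = i then pinf (p i) r else none

/-- The `i`-th indicator `Υ_i`: `𝐢` in coordinate `i` and `𝐜` elsewhere. -/
def indicator {A : Type*} {N : ℕ} (i : Fin N) : Fin N → Pbar A :=
  fun j => if j = i then some (indiff A) else none

/-- Coordinatewise negation on tuples. -/
noncomputable def negT {A : Type*} {N : ℕ} (p : Fin N → Pbar A) : Fin N → Pbar A :=
  fun j => pneg (p j)

/-- Coordinatewise extended strictness order on tuples. -/
def leT {A : Type*} {N : ℕ} (s t : Fin N → Pbar A) : Prop :=
  ∀ j, barLE (s j) (t j)

/-- `p ∗ q := Ω_i(p, w(q))` in the Self-Reference System `(w, Ω_i)`. -/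
noncomputable def starOmega {A : Type*} {N : ℕ} (w : (Fin N → Pbar A) → Pbar A) (i : Fin N)
    (p q : Fin N → Pbar A) : Fin N → Pbar A :=
  Omega i p (w q)

/-- Two tuples are consistent (`s ⋈ t`) iff `s_j ⊓ t_j ≠ 𝐜` in every coordinate. -/
def Consistent {A : Type*} {N : ℕ} (s t : Fin N → Pbar A) : Prop :=
  ∀ j, pinf (s j) (t j) ≠ none

/-- `(Υ, d)` satisfies quasi-consistency in `(w, Ω_i)`: `d ≤ ¬(Υ ∗ ¬d)`. -/
noncomputable def QuasiConsistent {A : Type*} {N : ℕ} (w : (Fin N → Pbar A) → Pbar A)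
    (i : Fin N) (Υ d : Fin N → Pbar A) : Prop :=
  leT d (negT (starOmega w i Υ (negT d)))

/-- `d` is a quasi-Gödel sentence w.r.t. `Υ` in `(w, Ω_i)`: `d ≤ ¬(Υ ∗ d)`. -/
noncomputable def QuasiGodelSentence {A : Type*} {N : ℕ} (w : (Fin N → Pbar A) → Pbar A)
    (i : Fin N) (Υ d : Fin N → Pbar A) : Prop :=
  leT d (negT (starOmega w i Υ d))

/-- `(Υ, d)` satisfies quasi-completeness in `(w, Ω_i)`:
`¬(Υ ∗ d)` and `¬(Υ ∗ ¬d)` are inconsistent. -/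
noncomputable def QuasiComplete {A : Type*} {N : ℕ} (w : (Fin N → Pbar A) → Pbar A)
    (i : Fin N) (Υ d : Fin N → Pbar A) : Prop :=
  ¬ Consistent (negT (starOmega w i Υ d)) (negT (starOmega w i Υ (negT d)))

/-- `(w, Ω_i)` is a quasi-Gödelian system with respect to `Υ`. -/
noncomputable def QuasiGodelian {A : Type*} {N : ℕ} (w : (Fin N → Pbar A) → Pbar A)
    (i : Fin N) (Υ : Fin N → Pbar A) : Prop :=
  ∃ d : Fin N → WeakOrder A,
    QuasiGodelSentence w i Υ (coeP d) ∧
    ¬ (QuasiConsistent w i Υ (coeP d) ∧ QuasiComplete w i Υ (coeP d))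

/-- `a ≺ b` in `x ∈ P̄` (`𝐜` is regarded as containing every strict preference). -/
def strictIn {A : Type*} (x : Pbar A) (a b : A) : Prop :=
  match x with
  | none => True
  | some r => r.strict a b

/-- Unanimity for an extended Social Welfare Function. -/
def Unanimity {A : Type*} {N : ℕ} (w : (Fin N → Pbar A) → Pbar A) : Prop :=
  ∀ (p : Fin N → WeakOrder A) (a b : A),
    (∀ j, (p j).strict a b) → strictIn (w (coeP p)) a b

/-- Independence of Irrelevant Alternatives for an extended Social Welfare Function. -/
def IIA {A : Type*} {N : ℕ} (w : (Fin N → Pbar A) → Pbar A) : Prop :=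
  ∀ (p q : Fin N → WeakOrder A) (a b : A),
    (∀ j, ((p j).strict a b ↔ (q j).strict a b) ∧ ((p j).strict b a ↔ (q j).strict b a)) →
    ((strictIn (w (coeP p)) a b ↔ strictIn (w (coeP q)) a b) ∧
     (strictIn (w (coeP p)) b a ↔ strictIn (w (coeP q)) b a))

namespace WeakOrder

variable {A : Type*}

theorem strict_trans {r : WeakOrder A} {a b c : A} (hab : r.strict a b) (hbc : r.strict b c) :
    r.strict a c :=
  ⟨r.trans _ _ _ hab.1 hbc.1, fun hca => hab.2 (r.trans _ _ _ hbc.1 hca)⟩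

theorem strict_asymm {r : WeakOrder A} {a b : A} (hab : r.strict a b) : ¬ r.strict b a :=
  fun hba => hab.2 hba.1

theorem rel_of_not_strict {r : WeakOrder A} {a b : A} (h : ¬ r.strict a b) : r.rel b a :=
  (r.total b a).elim id fun hab => by_contra fun hba => h ⟨hab, hba⟩

theorem strict_of_rel_of_strict {r : WeakOrder A} {a b c : A} (hab : r.rel a b)
    (hbc : r.strict b c) : r.strict a c :=
  ⟨r.trans _ _ _ hab hbc.1, fun hca => hbc.2 (r.trans _ _ _ hca hab)⟩

/-- The weak order represented by a utility function. -/
def ofUtility (u : A → ℕ) : WeakOrder A :=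
  ⟨fun a b => u a ≤ u b, fun _ _ _ => le_trans, fun _ _ => le_total _ _⟩

theorem ofUtility_strict {u : A → ℕ} {a b : A} : (ofUtility u).strict a b ↔ u a < u b := by
  simp only [strict, ofUtility]
  omega

open Classical in
/-- The weak order giving `a` rank `x`, `b` rank `y` and every other alternative rank `z`. -/
noncomputable def ofRanks (a b : A) (x y z : ℕ) : WeakOrder A :=
  ofUtility fun t => if t = a then x else if t = b then y else z

open Classical in
/-- A rank of `b` relative to rank `1` for `a` reproducing the comparison in `r`. -/
noncomputable def relativeRank (r : WeakOrder A) (a b : A) : ℕ :=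
  if r.strict a b then 2 else if r.strict b a then 0 else 1

theorem one_lt_relativeRank {r : WeakOrder A} {a b : A} :
    1 < r.relativeRank a b ↔ r.strict a b := by
  unfold relativeRank
  split_ifs <;> simp_all

theorem relativeRank_lt_one {r : WeakOrder A} {a b : A} :
    r.relativeRank a b < 1 ↔ r.strict b a := by
  unfold relativeRank
  split_ifs with h <;> simp_all [strict_asymm]

end WeakOrder

section Arrow

open WeakOrder

variable {A ι : Type*}

/-- Unanimity for a social welfare function valued in weak orders. -/
def IsUnanimous (f : (ι → WeakOrder A) → WeakOrder A) : Prop :=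
  ∀ p a b, (∀ j, (p j).strict a b) → (f p).strict a b

/-- Independence of irrelevant alternatives for a social welfare function valued in
weak orders. -/
def IsIndependent (f : (ι → WeakOrder A) → WeakOrder A) : Prop :=
  ∀ p q a b, (∀ j, ((p j).strict a b ↔ (q j).strict a b) ∧
    ((p j).strict b a ↔ (q j).strict b a)) → (f p).strict a b → (f q).strict a b

/-- The coalition `S` can impose `a ≺ b` whatever the others prefer. -/
def IsDecisive (f : (ι → WeakOrder A) → WeakOrder A) (S : Set ι) (a b : A) : Prop :=
  ∀ p, (∀ j ∈ S, (p j).strict a b) → (f p).strict a b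

/-- The coalition `S` can impose `a ≺ b` against unanimous opposition. -/
def IsWeaklyDecisive (f : (ι → WeakOrder A) → WeakOrder A) (S : Set ι) (a b : A) : Prop :=
  ∀ p, (∀ j ∈ S, (p j).strict a b) → (∀ j ∉ S, (p j).strict b a) → (f p).strict a b

variable {f : (ι → WeakOrder A) → WeakOrder A} {S : Set ι} {a b c : A}

theorem IsDecisive.isWeaklyDecisive (h : IsDecisive f S a b) : IsWeaklyDecisive f S a b :=
  fun p hS _ => h p hS

theorem IsIndependent.isWeaklyDecisive_of_profile (hI : IsIndependent f) (p : ι → WeakOrder A)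
    (hS : ∀ j ∈ S, (p j).strict a b) (hS' : ∀ j ∉ S, (p j).strict b a)
    (h : (f p).strict a b) : IsWeaklyDecisive f S a b := by
  intro q hq hq'
  refine hI p q a b (fun j => ?_) h
  by_cases hj : j ∈ S
  · simp [hS j hj, hq j hj, strict_asymm]
  · simp [hS' j hj, hq' j hj, strict_asymm]

open Classical in
theorem IsWeaklyDecisive.isDecisive_right (hU : IsUnanimous f) (hI : IsIndependent f)
    (h : IsWeaklyDecisive f S a b) (hab : a ≠ b) (hca : c ≠ a) (hcb : c ≠ b) :
    IsDecisive f S a c := by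
  intro p hp
  let q : ι → WeakOrder A := fun j =>
    if j ∈ S then ofRanks a b 0 1 2 else ofRanks a b 2 0 (1 + (p j).relativeRank a c)
  have hqab : (f q).strict a b := by
    apply h q <;> intro j hj <;> simp [q, hj, ofRanks, ofUtility_strict, hab.symm]
  have hqbc : (f q).strict b c := by
    refine hU q b c fun j => ?_
    by_cases hj : j ∈ S <;> simp [q, hj, ofRanks, ofUtility_strict, hab.symm, hca, hcb]
  refine hI q p a c (fun j => ?_) (strict_trans hqab hqbc)
  by_cases hj : j ∈ S
  · simp [q, hj, ofRanks, ofUtility_strict, hca, hcb, hp j hj, strict_asymm]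
  · have h₁ := one_lt_relativeRank (r := p j) (a := a) (b := c)
    have h₂ := relativeRank_lt_one (r := p j) (a := a) (b := c)
    simp only [q, hj, if_false, ofRanks, ofUtility_strict, hca, hcb, if_true, ← h₁, ← h₂]
    omega

open Classical in
theorem IsWeaklyDecisive.isDecisive_left (hU : IsUnanimous f) (hI : IsIndependent f)
    (h : IsWeaklyDecisive f S a b) (hab : a ≠ b) (hca : c ≠ a) (hcb : c ≠ b) :
    IsDecisive f S c b := by
  intro p hp
  let q : ι → WeakOrder A := fun j =>
    if j ∈ S then ofRanks a b 1 2 0 else ofRanks a b 3 ((p j).relativeRank c b) 1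
  have hlt (j : ι) : (p j).relativeRank c b < 3 := by
    unfold relativeRank
    split_ifs <;> omega
  have hqab : (f q).strict a b := by
    apply h q <;> intro j hj <;> simp [q, hj, ofRanks, ofUtility_strict, hab.symm, hlt]
  have hqca : (f q).strict c a := by
    refine hU q c a fun j => ?_
    by_cases hj : j ∈ S <;> simp [q, hj, ofRanks, ofUtility_strict, hca, hcb]
  refine hI q p c b (fun j => ?_) (strict_trans hqca hqab)
  by_cases hj : j ∈ S
  · simp [q, hj, ofRanks, ofUtility_strict, hab.symm, hca, hcb, hp j hj, strict_asymm]
  · simp only [q, hj, if_false, ofRanks, ofUtility_strict, hca, hcb, hab.symm, if_true,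
      one_lt_relativeRank, relativeRank_lt_one, and_self]

theorem IsWeaklyDecisive.isDecisive (hU : IsUnanimous f) (hI : IsIndependent f)
    (h3 : ∀ a b : A, ∃ c, c ≠ a ∧ c ≠ b) (h : IsWeaklyDecisive f S a b) (hab : a ≠ b)
    {x y : A} (hxy : x ≠ y) : IsDecisive f S x y := by
  have right {a b c : A} (h : IsDecisive f S a b) (hab : a ≠ b) (hca : c ≠ a) :
      IsDecisive f S a c := by
    by_cases hcb : c = b
    · exact hcb ▸ h
    · exact h.isWeaklyDecisive.isDecisive_right hU hI hab hca hcb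
  have left {a b c : A} (h : IsDecisive f S a b) (hab : a ≠ b) (hcb : c ≠ b) :
      IsDecisive f S c b := by
    by_cases hca : c = a
    · exact hca ▸ h
    · exact h.isWeaklyDecisive.isDecisive_left hU hI hab hca hcb
  obtain ⟨c, hca, hcb⟩ := h3 a b
  obtain ⟨d, hda, hdx⟩ := h3 a x
  have had : IsDecisive f S a d :=
    right (h.isDecisive_right hU hI hab hca hcb) hca.symm hda
  exact right (left had hda.symm hdx.symm) hdx.symm hxy.symm

open Classical in
theorem exists_isWeaklyDecisive_singleton (hU : IsUnanimous f) (hI : IsIndependent f)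
    (h3 : ∀ a b : A, ∃ c, c ≠ a ∧ c ≠ b) (S : Finset ι) :
    ∀ a b, a ≠ b → IsWeaklyDecisive f S a b →
      ∃ i x y, x ≠ y ∧ IsWeaklyDecisive f {i} x y := by
  induction S using Finset.induction_on with
  | empty =>
    intro a b hab h
    have hba := hU (fun _ => ofRanks a b 1 0 0) b a
      fun j => by simp [ofRanks, ofUtility_strict, hab.symm]
    refine absurd (h (fun _ => ofRanks a b 1 0 0) (by simp) fun j _ => ?_) (strict_asymm hba)
    simp [ofRanks, ofUtility_strict, hab.symm]
  | insert i S hi ih =>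
    intro a b hab h
    obtain ⟨c, hca, hcb⟩ := h3 a b
    let q : ι → WeakOrder A := fun j =>
      if j = i then ofRanks a b 0 1 2
      else if j ∈ S then ofRanks a b 1 2 0 else ofRanks a b 2 0 1
    have hqab : (f q).strict a b := by
      apply h q <;> intro j hj
      · by_cases hji : j = i
        · simp [q, hji, ofRanks, ofUtility_strict, hab.symm]
        · have hjS : j ∈ S := by simpa [hji] using hj
          simp [q, hji, hjS, ofRanks, ofUtility_strict, hab.symm]
      · obtain ⟨hji, hjS⟩ : j ≠ i ∧ j ∉ S := by simpa using hj
        simp [q, hji, hjS, ofRanks, ofUtility_strict, hab.symm]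
    by_cases hac : (f q).strict a c
    · refine ⟨i, a, c, hca.symm, hI.isWeaklyDecisive_of_profile q ?_ ?_ hac⟩
      · simp [q, ofRanks, ofUtility_strict, hca, hcb]
      · intro j hj
        have hji : j ≠ i := hj
        by_cases hjS : j ∈ S <;> simp [q, hji, hjS, ofRanks, ofUtility_strict, hca, hcb]
    · refine ih c b hcb (hI.isWeaklyDecisive_of_profile q (fun j hj => ?_) (fun j hj => ?_)
        (strict_of_rel_of_strict (rel_of_not_strict hac) hqab))
      · have hjS : j ∈ S := hj
        have hji : j ≠ i := fun e => hi (e ▸ hjS)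
        simp [q, hji, hjS, ofRanks, ofUtility_strict, hca, hcb, hab.symm]
      · have hjS : j ∉ S := hj
        by_cases hji : j = i <;>
          simp [q, hji, hjS, ofRanks, ofUtility_strict, hca, hcb, hab.symm]

/-- **Arrow's theorem** for social welfare functions valued in weak orders. -/
theorem exists_dictator [Finite ι] [Nonempty A] (hU : IsUnanimous f) (hI : IsIndependent f)
    (h3 : ∀ a b : A, ∃ c, c ≠ a ∧ c ≠ b) : ∃ i, ∀ p, strLE (f p) (p i) := by
  have := Fintype.ofFinite ι
  obtain ⟨a⟩ := ‹Nonempty A›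
  obtain ⟨b, hba, -⟩ := h3 a a
  obtain ⟨i, x, y, hxy, h⟩ := exists_isWeaklyDecisive_singleton hU hI h3 Finset.univ a b
    hba.symm fun p hp _ => hU p a b fun j => hp j (by simp)
  refine ⟨i, fun p c d hcd => ?_⟩
  have hne : c ≠ d := by
    rintro rfl
    exact strict_asymm hcd hcd
  exact h.isDecisive hU hI h3 hxy hne p (by simpa using hcd)

theorem pinf_eq_none_of_strict {r s : WeakOrder A} (hr : r.strict a b) (hs : s.strict b a) :
    pinf (some r) (some s) = none := by
  unfold pinf
  split_ifs with h
  · obtain ⟨h₁, h₂, -⟩ := h.choose_spec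
    match ht : h.choose with
    | none => rfl
    | some t =>
      rw [ht] at h₁ h₂
      exact absurd (h₂ _ _ hs) (strict_asymm (h₁ _ _ hr))
  · rfl

/-- Independence at a pair `(a, a)` shows that the value `𝐜` is taken everywhere or nowhere. -/
theorem IIA.eq_none_iff [Nonempty A] {N : ℕ} {w : (Fin N → Pbar A) → Pbar A} (h : IIA w)
    (p q : Fin N → WeakOrder A) : w (coeP p) = none ↔ w (coeP q) = none := by
  obtain ⟨a⟩ := ‹Nonempty A›
  have strictIn_self (x : Pbar A) : strictIn x a a ↔ x = none := by
    cases x <;> simp [strictIn, WeakOrder.strict]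
  rw [← strictIn_self, ← strictIn_self]
  exact (h p q a a fun j => by simp [WeakOrder.strict]).1

theorem exists_ne_ne_of_three_le_card (hA : 3 ≤ Nat.card A) (a b : A) :
    ∃ c, c ≠ a ∧ c ≠ b := by
  by_contra! h
  have huniv : ({a, b} : Set A) = Set.univ := by
    ext c
    by_cases hc : c = a
    · simp [hc]
    · simp [h c hc]
  have hle := Set.ncard_insert_le a {b}
  rw [huniv, Set.ncard_univ, Set.ncard_singleton] at hle
  omega

end Arrow

/-- **Arrow's Impossibility Theorem, extended form.** If `𝒜` is
finite with at least 3 elements, `N ≥ 2`, and `w : P̄^N → P̄` satisfies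
Unanimity, IIA and has no dictator at any individual, then there are profiles
`q, q' ∈ P^N` with `w(q) = w(q') = 𝐜` and `q_j ⊓ q'_j = 𝐜` for some `j`. -/
theorem arrow_extended {A : Type*} [Finite A] (hA : 3 ≤ Nat.card A)
    {N : ℕ} (hN : 2 ≤ N) (w : (Fin N → Pbar A) → Pbar A)
    (hU : Unanimity w) (hIIA : IIA w) (hND : ∀ i : Fin N, ¬ HasDictatorAt w i) :
    ∃ q q' : Fin N → WeakOrder A,
      w (coeP q) = none ∧ w (coeP q') = none ∧
      ∃ j : Fin N, pinf (some (q j)) (some (q' j)) = none := by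
  have h3 := exists_ne_ne_of_three_le_card hA
  have : Nonempty A := (Nat.card_pos_iff.mp (by omega)).1
  by_cases hc : w (coeP fun _ => indiff A) = none
  · have hall (p) : w (coeP p) = none := (hIIA.eq_none_iff _ p).mp hc
    obtain ⟨a⟩ := ‹Nonempty A›
    obtain ⟨b, hba, -⟩ := h3 a a
    refine ⟨fun _ => .ofRanks a b 0 1 2, fun _ => .ofRanks a b 1 0 2, hall _, hall _,
      ⟨0, by omega⟩, pinf_eq_none_of_strict (a := a) (b := b) ?_ ?_⟩ <;>
      simp [WeakOrder.ofRanks, WeakOrder.ofUtility_strict, hba]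
  · have hsome (p) : ∃ r, w (coeP p) = some r :=
      Option.ne_none_iff_exists'.mp (mt (hIIA.eq_none_iff p _).mp hc)
    choose f hf using hsome
    obtain ⟨i, hi⟩ := exists_dictator (f := f)
      (fun p a b h => by simpa [hf, strictIn] using hU p a b h)
      (fun p q a b h => by simpa [hf, strictIn] using (hIIA p q a b h).1.mp) h3
    refine absurd (fun p => ⟨fun h => ?_, fun _ => ?_⟩) (hND i)
    · simp [hf] at h
    · rw [hf]
      exact hi p
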